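/- arXiv:1810.09503 — 7 statements merged into one kernel-verified Lean document; each statement's English description precedes it below -/
import Mathlib

section
/- Let φ: ℝ → [0,∞) be a deformed exponential function (a convex function with lim_{u→-∞} φ(u) = 0 and lim_{u→∞} φ(u) = ∞) which is strictly increasing and differentiable with positive derivative on its interior of positivity, and suppose its inverse φ⁻¹: (0,∞) → ℝ is differentiable and concave. Then for all probability distributions p = (p₁,…,pₙ) and q = (q₁,…,qₙ) with p_i > 0 and q_i > 0 for all i and ∑ p_i = ∑ q_i = 1, the generalized divergence D_φ(p‖q) = ∑_{i=1}^{n} (φ⁻¹(p_i) − φ⁻¹(q_i)) / (φ⁻¹)'(p_i) is non-negative. -/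
open Filter Set

/-- A concave function lies below each of its tangent lines. -/
theorem ConcaveOn.le_tangent_of_hasDerivAt {s : Set ℝ} {f : ℝ → ℝ} {f' x y : ℝ}
    (hf : ConcaveOn ℝ s f) (hx : x ∈ s) (hy : y ∈ s) (hd : HasDerivAt f f' x) :
    f y ≤ f x + f' * (y - x) := by
  rcases lt_trichotomy x y with hxy | rfl | hxy
  · have h := hf.slope_le_of_hasDerivAt hx hy hxy hd
    rw [slope_def_field, div_le_iff₀ (sub_pos.2 hxy)] at h
    linarith
  · simp
  · have h := hf.le_slope_of_hasDerivAt hy hx hxy hd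
    rw [slope_def_field, le_div_iff₀ (sub_pos.2 hxy)] at h
    linarith

/-- If `g` is a right inverse of `f` near `x` and `f` has a positive derivative at `g x`,
then the derivative of `g` at `x` is positive. -/
theorem HasDerivAt.pos_of_eventually_rightInverse {f g : ℝ → ℝ} {f' g' x : ℝ}
    (hf : HasDerivAt f f' (g x)) (hg : HasDerivAt g g' x) (hf' : 0 < f')
    (hfg : ∀ᶠ y in nhds x, f (g y) = y) : 0 < g' := by
  have h : f' * g' = 1 := (hf.comp x hg).unique ((hasDerivAt_id x).congr_of_eventuallyEq hfg)
  exact pos_of_mul_pos_right (h ▸ one_pos) hf'.le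

/-- Non-negativity of the generalized divergence
`D_φ(p‖q) = ∑ (φ⁻¹(pᵢ) − φ⁻¹(qᵢ)) / (φ⁻¹)'(pᵢ)` for a deformed exponential `φ`
whose inverse is differentiable and concave. -/
theorem generalized_divergence_nonneg
    (φ φd φinv φinv' : ℝ → ℝ)
    -- φ is a deformed exponential function with values in [0,∞)
    (hφnn : ∀ u, 0 ≤ φ u)
    (hφconv : ConvexOn ℝ Set.univ φ)
    (hφbot : Tendsto φ atBot (nhds 0))
    (hφtop : Tendsto φ atTop atTop)
    -- φ is strictly increasing on its set of positivity
    (hφmono : StrictMonoOn φ {u | 0 < φ u})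
    -- φ is differentiable with positive derivative on the interior of its set of positivity
    (hφd : ∀ u ∈ interior {u | 0 < φ u}, HasDerivAt φ (φd u) u ∧ 0 < φd u)
    -- φinv is the inverse of φ
    (hinv_left : ∀ u, 0 < φ u → φinv (φ u) = u)
    (hinv_right : ∀ x : ℝ, 0 < x → φ (φinv x) = x)
    -- φinv is differentiable on (0,∞) with derivative φinv'
    (hinvd : ∀ x : ℝ, 0 < x → HasDerivAt φinv (φinv' x) x)
    -- φinv is concave on (0,∞)
    (hconc : ConcaveOn ℝ (Set.Ioi 0) φinv)
    -- p and q are probability distributions with strictly positive entries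
    (n : ℕ) (p q : Fin n → ℝ)
    (hp : ∀ i, 0 < p i) (hq : ∀ i, 0 < q i)
    (hps : ∑ i, p i = 1) (hqs : ∑ i, q i = 1) :
    0 ≤ ∑ i, (φinv (p i) - φinv (q i)) / φinv' (p i) := by
  have hopen : IsOpen {u | 0 < φ u} :=
    isOpen_lt continuous_const (continuousOn_univ.1 (hφconv.continuousOn isOpen_univ))
  have hpos (x : ℝ) (hx : 0 < x) : 0 < φinv' x := by
    have hmem : φinv x ∈ interior {u | 0 < φ u} := by
      rw [hopen.interior_eq, mem_ofPred_eq, hinv_right x hx]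
      exact hx
    obtain ⟨hd, hd_pos⟩ := hφd _ hmem
    exact hd.pos_of_eventually_rightInverse (hinvd x hx) hd_pos
      ((eventually_gt_nhds hx).mono hinv_right)
  calc (0 : ℝ) = ∑ i, (p i - q i) := by rw [Finset.sum_sub_distrib, hps, hqs, sub_self]
    _ ≤ ∑ i, (φinv (p i) - φinv (q i)) / φinv' (p i) := by
      refine Finset.sum_le_sum fun i _ => ?_
      rw [le_div_iff₀ (hpos _ (hp i))]
      linarith [hconc.le_tangent_of_hasDerivAt (mem_Ioi.2 (hp i)) (mem_Ioi.2 (hq i))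
        (hinvd _ (hp i))]
end

section
/- Let φ: ℝ → [0,∞) be a deformed exponential function which is strictly increasing and differentiable with positive derivative on its interior of positivity, and suppose its inverse φ⁻¹: (0,∞) → ℝ is differentiable and strictly concave. Then for probability distributions p = (p_i) and q = (q_i) with strictly positive entries, the generalized divergence satisfies D_φ(p‖q) = 0 if and only if p = q. -/
open Filter Set

/-- A strictly concave function lies strictly below its tangent lines, away from the point of
tangency. -/
theorem StrictConcaveOn.sub_lt_mul_sub_of_hasDerivAt {S : Set ℝ} {f : ℝ → ℝ} {f' x y : ℝ}
    (hf : StrictConcaveOn ℝ S f) (hx : x ∈ S) (hy : y ∈ S) (hxy : x ≠ y)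
    (hd : HasDerivAt f f' x) : f y - f x < f' * (y - x) := by
  rcases lt_or_gt_of_ne hxy with h | h
  · have := hf.slope_lt_of_hasDerivAt hx hy h hd
    rwa [slope_def_field, div_lt_iff₀ (sub_pos.mpr h)] at this
  · have := hf.lt_slope_of_hasDerivAt hy hx h hd
    rw [slope_def_field, lt_div_iff₀ (sub_pos.mpr h)] at this
    linarith

/-- A right inverse, on the positive reals, of a function that is strictly increasing where it is
positive is itself strictly increasing. -/
theorem strictMonoOn_Ioi_of_rightInverse {φ ψ : ℝ → ℝ} (hφ : StrictMonoOn φ {u | 0 < φ u})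
    (hψ : ∀ x : ℝ, 0 < x → φ (ψ x) = x) : StrictMonoOn ψ (Set.Ioi 0) := by
  intro x hx y hy hxy
  have hmem : ∀ z : ℝ, 0 < z → ψ z ∈ {u | 0 < φ u} := fun z hz => by
    simpa only [Set.mem_ofPred_eq, hψ z hz] using hz
  rw [← hφ.lt_iff_lt (hmem x hx) (hmem y hy), hψ x hx, hψ y hy]
  exact hxy

/-- For a deformed exponential `φ` whose inverse is differentiable and strictly concave,
the generalized divergence vanishes exactly on the diagonal: `D_φ(p‖q) = 0 ↔ p = q`. -/
theorem generalized_divergence_eq_zero_iff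
    (φ φd φinv φinv' : ℝ → ℝ)
    -- φ is a deformed exponential function with values in [0,∞)
    (hφnn : ∀ u, 0 ≤ φ u)
    (hφconv : ConvexOn ℝ Set.univ φ)
    (hφbot : Tendsto φ atBot (nhds 0))
    (hφtop : Tendsto φ atTop atTop)
    -- φ is strictly increasing on its set of positivity
    (hφmono : StrictMonoOn φ {u | 0 < φ u})
    -- φ is differentiable with positive derivative on the interior of its set of positivity
    (hφd : ∀ u ∈ interior {u | 0 < φ u}, HasDerivAt φ (φd u) u ∧ 0 < φd u)
    -- φinv is the inverse of φ
    (hinv_left : ∀ u, 0 < φ u → φinv (φ u) = u)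
    (hinv_right : ∀ x : ℝ, 0 < x → φ (φinv x) = x)
    -- φinv is differentiable on (0,∞) with derivative φinv'
    (hinvd : ∀ x : ℝ, 0 < x → HasDerivAt φinv (φinv' x) x)
    -- φinv is strictly concave on (0,∞)
    (hconc : StrictConcaveOn ℝ (Set.Ioi 0) φinv)
    -- p and q are probability distributions with strictly positive entries
    (n : ℕ) (p q : Fin n → ℝ)
    (hp : ∀ i, 0 < p i) (hq : ∀ i, 0 < q i)
    (hps : ∑ i, p i = 1) (hqs : ∑ i, q i = 1) :
    ∑ i, (φinv (p i) - φinv (q i)) / φinv' (p i) = 0 ↔ p = q := by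
  constructor
  · intro h
    have hmono := strictMonoOn_Ioi_of_rightInverse hφmono hinv_right
    have hpos : ∀ x : ℝ, 0 < x → 0 < φinv' x := by
      intro x hx
      have hx1 : (0 : ℝ) < x + 1 := by linarith
      have hlt : x < x + 1 := by linarith
      have h1 := hconc.sub_lt_mul_sub_of_hasDerivAt hx hx1 hlt.ne (hinvd x hx)
      have h2 := hmono hx hx1 hlt
      linarith
    have hterm : ∀ i, p i ≠ q i →
        p i - q i < (φinv (p i) - φinv (q i)) / φinv' (p i) := by
      intro i hi
      have h1 := hconc.sub_lt_mul_sub_of_hasDerivAt (hp i) (hq i) hi (hinvd _ (hp i))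
      rw [lt_div_iff₀ (hpos _ (hp i))]
      linarith
    have hle : ∀ i ∈ Finset.univ,
        p i - q i ≤ (φinv (p i) - φinv (q i)) / φinv' (p i) := by
      intro i _
      by_cases hi : p i = q i
      · simp [hi]
      · exact (hterm i hi).le
    have hsum : ∑ i, (p i - q i) = ∑ i, (φinv (p i) - φinv (q i)) / φinv' (p i) := by
      rw [h, Finset.sum_sub_distrib, hps, hqs, sub_self]
    funext i
    by_contra hi
    exact (hterm i hi).ne ((Finset.sum_eq_sum_iff_of_le hle).mp hsum i (Finset.mem_univ i))
  · rintro rfl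
    simp
end

section
/- Let φ: ℝ → (0,∞) be a strictly positive, strictly increasing, continuous deformed exponential function with lim_{u→-∞} φ(u) = 0 and lim_{u→∞} φ(u) = ∞. Fix c = (c₁,…,cₙ) ∈ ℝⁿ with ∑_{i=1}^{n} φ(c_i) = 1, assume φ is differentiable, fix u₀ = (u₀₁,…,u₀ₙ) with u₀ᵢ > 0 for all i and ∑_{i=1}^{n} u₀ᵢ φ'(c_i) = 1, and let u = (u₁,…,uₙ) satisfy ∑_{i=1}^{n} u_i φ'(c_i) = 0. Then there exists a unique λ₀ ≥ 0 such that ∑_{i=1}^{n} φ(c_i + u_i − λ₀ u₀ᵢ) = 1. -/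
open Filter Set

/-- A convex function on `ℝ` lies above each of its tangent lines. -/
theorem ConvexOn.add_mul_le_of_hasDerivAt {f : ℝ → ℝ} {f' x : ℝ}
    (hf : ConvexOn ℝ Set.univ f) (hx : HasDerivAt f f' x) (h : ℝ) :
    f x + h * f' ≤ f (x + h) := by
  rcases lt_trichotomy h 0 with hneg | rfl | hpos
  · have hs := hf.slope_le_of_hasDerivAt (mem_univ (x + h)) (mem_univ x) (by linarith) hx
    rw [slope_def_field, div_le_iff₀ (by linarith)] at hs
    linarith
  · simp
  · have hs := hf.le_slope_of_hasDerivAt (mem_univ x) (mem_univ (x + h)) (by linarith) hx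
    rw [slope_def_field, le_div_iff₀ (by linarith)] at hs
    linarith

/-- Existence and uniqueness of the normalizing constant `λ₀ = ψ_c(u)` of the
deformed exponential family centered at the probability distribution `pᵢ = φ(cᵢ)`. -/
theorem normalizing_function_exists_unique
    (φ φ' : ℝ → ℝ)
    -- φ is a strictly positive, strictly increasing, continuous deformed exponential
    (hφpos : ∀ u, 0 < φ u)
    (hφconv : ConvexOn ℝ Set.univ φ)
    (hφmono : StrictMono φ)
    (hφcont : Continuous φ)
    (hφbot : Tendsto φ atBot (nhds 0))
    (hφtop : Tendsto φ atTop atTop)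
    -- φ is differentiable with derivative φ'
    (hφd : ∀ u, HasDerivAt φ (φ' u) u)
    (n : ℕ) (c u₀ u : Fin n → ℝ)
    -- (φ(cᵢ)) is a probability distribution
    (hc : ∑ i, φ (c i) = 1)
    -- u₀ has positive entries and satisfies the normalization constraint
    (hu₀pos : ∀ i, 0 < u₀ i)
    (hu₀ : ∑ i, u₀ i * φ' (c i) = 1)
    -- u belongs to the subspace B_c^φ
    (hu : ∑ i, u i * φ' (c i) = 0) :
    ∃! l : ℝ, 0 ≤ l ∧ ∑ i, φ (c i + u i - l * u₀ i) = 1 := by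
  have hne : (Finset.univ : Finset (Fin n)).Nonempty :=
    Finset.nonempty_of_sum_ne_zero (hc ▸ one_ne_zero)
  set G : ℝ → ℝ := fun l => ∑ i, φ (c i + u i - l * u₀ i) with hG
  have hanti : StrictAnti G := fun a b hab =>
    Finset.sum_lt_sum_of_nonempty hne fun i _ =>
      hφmono (sub_lt_sub_left (mul_lt_mul_of_pos_right hab (hu₀pos i)) _)
  have hcont : Continuous G := by fun_prop
  have hlim : Tendsto G atTop (nhds 0) := by
    rw [← Finset.sum_const_zero (s := (Finset.univ : Finset (Fin n)))]
    refine tendsto_finsetSum _ fun i _ => hφbot.comp ?_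
    simp only [sub_eq_add_neg]
    exact tendsto_atBot_add_const_left _ _
      (tendsto_neg_atTop_atBot.comp (tendsto_id.atTop_mul_const (hu₀pos i)))
  have hzero : 1 ≤ G 0 := calc
    1 = ∑ i, (φ (c i) + u i * φ' (c i)) := by rw [Finset.sum_add_distrib, hc, hu, add_zero]
    _ ≤ ∑ i, φ (c i + u i) :=
      Finset.sum_le_sum fun i _ => hφconv.add_mul_le_of_hasDerivAt (hφd (c i)) (u i)
    _ = G 0 := by simp [hG]
  obtain ⟨b, hb, hb0⟩ :=
    ((hlim.eventually_lt_const one_pos).and (eventually_ge_atTop 0)).exists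
  obtain ⟨l, hl, hl1⟩ := intermediate_value_Icc' hb0 hcont.continuousOn ⟨hb.le, hzero⟩
  exact ⟨l, ⟨hl.1, hl1⟩, fun m hm => hanti.injective (hm.2.trans hl1.symm)⟩
end

section
/- Let φ: ℝ → (0,∞) be a strictly positive, strictly increasing, differentiable deformed exponential function whose inverse φ⁻¹ is differentiable with positive derivative. Fix c ∈ ℝⁿ with p_i = φ(c_i) defining a probability distribution, fix u₀ with u₀ᵢ > 0 and ∑ u₀ᵢ φ'(c_i) = 1, and let u satisfy ∑ u_i φ'(c_i) = 0. If λ₀ = ψ_c(u) ≥ 0 is such that q_i = φ(c_i + u_i − λ₀ u₀ᵢ) defines a probability distribution, then ψ_c(u) = D_φ(p‖q) = ∑_{i=1}^{n} (φ⁻¹(p_i) − φ⁻¹(q_i)) / (φ⁻¹)'(p_i). -/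
open Filter Set

/-- The normalizing function of the deformed exponential family equals the
generalized divergence: `ψ_c(u) = D_φ(p‖q)`. -/
theorem normalizing_function_eq_divergence
    (φ φ' φinv φinv' : ℝ → ℝ)
    -- φ is a strictly positive, strictly increasing, differentiable deformed exponential
    (hφpos : ∀ u, 0 < φ u)
    (hφconv : ConvexOn ℝ Set.univ φ)
    (hφmono : StrictMono φ)
    (hφbot : Tendsto φ atBot (nhds 0))
    (hφtop : Tendsto φ atTop atTop)
    (hφd : ∀ x, HasDerivAt φ (φ' x) x)
    -- φinv is the inverse of φ, differentiable with positive derivative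
    (hinv_left : ∀ x, φinv (φ x) = x)
    (hinv_right : ∀ y : ℝ, 0 < y → φ (φinv y) = y)
    (hinvd : ∀ y : ℝ, 0 < y → HasDerivAt φinv (φinv' y) y)
    (hinv'pos : ∀ y : ℝ, 0 < y → 0 < φinv' y)
    (n : ℕ) (c u₀ u p q : Fin n → ℝ) (l : ℝ)
    -- p is the probability distribution centered at c
    (hpc : ∀ i, p i = φ (c i)) (hps : ∑ i, p i = 1)
    -- u₀ has positive entries and satisfies the normalization constraint
    (hu₀pos : ∀ i, 0 < u₀ i)
    (hu₀ : ∑ i, u₀ i * φ' (c i) = 1)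
    -- u belongs to the subspace B_c^φ
    (hu : ∑ i, u i * φ' (c i) = 0)
    -- l = ψ_c(u) ≥ 0 is such that q is a probability distribution
    (hl : 0 ≤ l)
    (hqc : ∀ i, q i = φ (c i + u i - l * u₀ i)) (hqs : ∑ i, q i = 1) :
    l = ∑ i, (φinv (p i) - φinv (q i)) / φinv' (p i) := by
  have hterm : ∀ i, (φinv (p i) - φinv (q i)) / φinv' (p i)
      = l * (u₀ i * φ' (c i)) - u i * φ' (c i) := by
    intro i
    have hcomp : HasDerivAt (φinv ∘ φ) (φinv' (φ (c i)) * φ' (c i)) (c i) :=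
      (hinvd _ (hφpos _)).comp _ (hφd _)
    have hmul : φinv' (φ (c i)) * φ' (c i) = 1 := by
      rw [show φinv ∘ φ = id from funext hinv_left] at hcomp
      exact hcomp.unique (hasDerivAt_id _)
    rw [hqc, hpc, hinv_left, hinv_left, div_eq_iff (hinv'pos _ (hφpos _)).ne']
    linear_combination (u i - l * u₀ i) * hmul
  rw [Finset.sum_congr rfl fun i _ => hterm i, Finset.sum_sub_distrib, ← Finset.mul_sum, hu₀, hu]
  ring
end

section
/- Let φ: ℝ → (0,∞) be a strictly increasing deformed exponential function which is twice differentiable with φ' > 0, whose inverse φ⁻¹ on (0,∞) is twice differentiable with (φ⁻¹)' > 0 and (φ⁻¹)'' continuous and strictly negative, and set g(x) = −(φ⁻¹)'(x)/(φ⁻¹)''(x). Suppose that for all p₁, p₂, q₁, q₂ ∈ (0,1) with p₁+p₂ ∈ (0,1) and q₁+q₂ ∈ (0,1), the two-term partition inequality (φ⁻¹(p₁)−φ⁻¹(q₁))/(φ⁻¹)'(p₁) + (φ⁻¹(p₂)−φ⁻¹(q₂))/(φ⁻¹)'(p₂) ≥ (φ⁻¹(p₁+p₂)−φ⁻¹(q₁+q₂))/(φ⁻¹)'(p₁+p₂)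 holds. Then g is superadditive on (0,1): g(x+y) ≥ g(x)+g(y) whenever x, y, x+y ∈ (0,1). -/
open Filter Set

/-- The second derivative is nonnegative at a local minimum. -/
theorem IsLocalMin.deriv_deriv_nonneg {f : ℝ → ℝ} {a : ℝ} (hmin : IsLocalMin f a)
    (hc : ContinuousAt f a) : 0 ≤ deriv (deriv f) a := by
  by_contra! hneg
  have hmax : IsLocalMax f a := isLocalMax_of_deriv_deriv_neg hneg hmin.deriv_eq_zero hc
  have hconst : f =ᶠ[nhds a] fun _ => f a := by
    filter_upwards [hmin, hmax] with x h₁ h₂ using le_antisymm h₂ h₁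
  rw [hconst.deriv.deriv_eq] at hneg
  simp at hneg

/-- Necessity in Proposition 1: if the two-term partition inequality holds for
the generalized divergence, then `g = −(φ⁻¹)'/(φ⁻¹)''` is superadditive on `(0,1)`. -/
theorem superadditive_of_two_term_partition_inequality
    (φ φ' φ'' φinv φinv' φinv'' : ℝ → ℝ)
    -- φ is a strictly positive, strictly increasing deformed exponential
    (hφpos : ∀ u, 0 < φ u)
    (hφconv : ConvexOn ℝ Set.univ φ)
    (hφmono : StrictMono φ)
    (hφbot : Tendsto φ atBot (nhds 0))
    (hφtop : Tendsto φ atTop atTop)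
    -- φ is twice differentiable with φ' > 0
    (hφd : ∀ u, HasDerivAt φ (φ' u) u)
    (hφd2 : ∀ u, HasDerivAt φ' (φ'' u) u)
    (hφ'pos : ∀ u, 0 < φ' u)
    -- φinv is the inverse of φ
    (hinv_left : ∀ u, φinv (φ u) = u)
    (hinv_right : ∀ x : ℝ, 0 < x → φ (φinv x) = x)
    -- φinv is twice differentiable on (0,∞) with (φ⁻¹)' > 0 and (φ⁻¹)'' continuous, < 0
    (hinvd : ∀ x : ℝ, 0 < x → HasDerivAt φinv (φinv' x) x)
    (hinvd2 : ∀ x : ℝ, 0 < x → HasDerivAt φinv' (φinv'' x) x)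
    (hinv'pos : ∀ x : ℝ, 0 < x → 0 < φinv' x)
    (hinv''neg : ∀ x : ℝ, 0 < x → φinv'' x < 0)
    (hinv''cont : ContinuousOn φinv'' (Set.Ioi 0))
    (g : ℝ → ℝ) (hg : ∀ x, g x = -φinv' x / φinv'' x)
    -- the two-term partition inequality
    (htwo : ∀ p₁ p₂ q₁ q₂ : ℝ, p₁ ∈ Set.Ioo (0:ℝ) 1 → p₂ ∈ Set.Ioo (0:ℝ) 1 →
      q₁ ∈ Set.Ioo (0:ℝ) 1 → q₂ ∈ Set.Ioo (0:ℝ) 1 →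
      p₁ + p₂ ∈ Set.Ioo (0:ℝ) 1 → q₁ + q₂ ∈ Set.Ioo (0:ℝ) 1 →
      (φinv (p₁ + p₂) - φinv (q₁ + q₂)) / φinv' (p₁ + p₂) ≤
        (φinv p₁ - φinv q₁) / φinv' p₁ + (φinv p₂ - φinv q₂) / φinv' p₂) :
    ∀ x y : ℝ, x ∈ Set.Ioo (0:ℝ) 1 → y ∈ Set.Ioo (0:ℝ) 1 →
      x + y ∈ Set.Ioo (0:ℝ) 1 → g x + g y ≤ g (x + y) := by
  intro x y hx hy hxy
  have hx0 : 0 < x := hx.1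
  have hy0 : 0 < y := hy.1
  have hs0 : 0 < x + y := hxy.1
  have hgpos : ∀ z, 0 < z → 0 < g z := fun z hz => by
    rw [hg]
    exact div_pos_of_neg_of_neg (neg_neg_of_pos (hinv'pos z hz)) (hinv''neg z hz)
  have hratio : ∀ z, 0 < z → φinv'' z / φinv' z = -(1 / g z) := fun z hz => by
    have h₁ := (hinv'pos z hz).ne'
    have h₂ := (hinv''neg z hz).ne
    rw [hg]
    field_simp
  -- the gap in the two-term inequality along the line `(x, y) + t (g x, g y)`
  set a := g x with ha
  set b := g y with hb
  set F : ℝ → ℝ := fun t =>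
    (φinv x - φinv (x + t * a)) / φinv' x + (φinv y - φinv (y + t * b)) / φinv' y
      - (φinv (x + y) - φinv (x + y + t * (a + b))) / φinv' (x + y) with hF
  have hline : ∀ z c t : ℝ, HasDerivAt (fun t => z + t * c) c t := fun z c t => by
    simpa using ((hasDerivAt_id t).mul_const c).const_add z
  have hnear : ∀ z c : ℝ, z ∈ Ioo (0 : ℝ) 1 → ∀ᶠ t in nhds (0 : ℝ), z + t * c ∈ Ioo (0 : ℝ) 1 :=
    fun z c hz => (hline z c 0).continuousAt.eventually_mem
      (by simpa using Ioo_mem_nhds hz.1 hz.2)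
  have hderiv : ∀ᶠ t in nhds (0 : ℝ), HasDerivAt F
      (-(φinv' (x + t * a) * a) / φinv' x + -(φinv' (y + t * b) * b) / φinv' y
        - -(φinv' (x + y + t * (a + b)) * (a + b)) / φinv' (x + y)) t := by
    filter_upwards [hnear x a hx, hnear y b hy, hnear (x + y) (a + b) hxy] with t h₁ h₂ h₃
    have hterm : ∀ z c : ℝ, 0 < z + t * c →
        HasDerivAt (fun t => (φinv z - φinv (z + t * c)) / φinv' z)
          (-(φinv' (z + t * c) * c) / φinv' z) t := fun z c h =>
      (((hinvd _ h).comp t (hline z c t)).const_sub (φinv z)).div_const _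
    exact ((hterm x a h₁.1).add (hterm y b h₂.1)).sub (hterm (x + y) (a + b) h₃.1)
  have hderiv2 : HasDerivAt (deriv F)
      (-(φinv'' x * a * a) / φinv' x + -(φinv'' y * b * b) / φinv' y
        - -(φinv'' (x + y) * (a + b) * (a + b)) / φinv' (x + y)) 0 := by
    have hterm : ∀ z c : ℝ, 0 < z →
        HasDerivAt (fun t => -(φinv' (z + t * c) * c) / φinv' z)
          (-(φinv'' z * c * c) / φinv' z) 0 := fun z c h => by
      have hz : HasDerivAt φinv' (φinv'' z) (z + 0 * c) := by simpa using hinvd2 z h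
      exact (((hz.comp 0 (hline z c 0)).mul_const c).neg).div_const _
    refine (((hterm x a hx0).add (hterm y b hy0)).sub
      (hterm (x + y) (a + b) hs0)).congr_of_eventuallyEq ?_
    filter_upwards [hderiv] with t ht using ht.deriv
  have hmin : IsLocalMin F 0 := by
    filter_upwards [hnear x a hx, hnear y b hy, hnear (x + y) (a + b) hxy] with t h₁ h₂ h₃
    have hsum : x + t * a + (y + t * b) = x + y + t * (a + b) := by ring
    have h := htwo x y (x + t * a) (y + t * b) hx hy h₁ h₂ hxy (hsum ▸ h₃)
    rw [hsum] at h
    simp only [hF, zero_mul, add_zero, sub_self, zero_div]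
    linarith
  have hnonneg := hmin.deriv_deriv_nonneg hderiv.self_of_nhds.continuousAt
  rw [hderiv2.deriv] at hnonneg
  have hpa : 0 < a := hgpos x hx0
  have hpb : 0 < b := hgpos y hy0
  have hps : 0 < g (x + y) := hgpos _ hs0
  have hquad : ∀ z c : ℝ, 0 < z → -(φinv'' z * c * c) / φinv' z = c * c / g z :=
    fun z c hz => by
      calc -(φinv'' z * c * c) / φinv' z = -(φinv'' z / φinv' z) * (c * c) := by ring
        _ = c * c / g z := by rw [hratio z hz]; ring
  rw [hquad x a hx0, hquad y b hy0, hquad (x + y) (a + b) hs0, ← ha, ← hb,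
    mul_self_div_self, mul_self_div_self, sub_nonneg, div_le_iff₀ hps] at hnonneg
  exact le_of_mul_le_mul_left hnonneg (add_pos hpa hpb)
end

section
/- Let g: (0,1) → ℝ be a continuous function with g > 0 on (0,1/2), such that g is superadditive on (0,1) (g(x+y) ≥ g(x)+g(y) whenever x, y, x+y ∈ (0,1)) and satisfies the midpoint concavity inequality g((x+y)/2) ≥ (g(x)+g(y))/2 for all x, y ∈ (0,1) with x+y ∈ (0,1). Then there exists q > 0 such that g(x) = x/q for all x ∈ (0,1). -/
open Set Filter Topology

/-- A nonnegative superadditive function on `(0,1)` satisfies `n * g y ≤ g x` as soon as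
`n * y ≤ x`. -/
theorem natCast_mul_le_of_superadditive {g : ℝ → ℝ}
    (hnonneg : ∀ x ∈ Ioo (0 : ℝ) 1, 0 ≤ g x)
    (hsuper : ∀ x y : ℝ, x ∈ Ioo (0 : ℝ) 1 → y ∈ Ioo (0 : ℝ) 1 →
      x + y ∈ Ioo (0 : ℝ) 1 → g x + g y ≤ g (x + y))
    {y : ℝ} (hy : 0 < y) (n : ℕ) {x : ℝ} (hx : x ∈ Ioo (0 : ℝ) 1) (hnx : n * y ≤ x) :
    n * g y ≤ g x := by
  induction n generalizing x with
  | zero => simpa using hnonneg x hx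
  | succ n ih =>
    push_cast at hnx ⊢
    have hny : 0 ≤ n * y := by positivity
    rcases (show y ≤ x by linarith).eq_or_lt with rfl | hlt
    · have hn : (n : ℝ) = 0 := by
        have : n * y = 0 := by linarith
        simpa [hy.ne'] using this
      simp [hn]
    · have hxy : x - y ∈ Ioo (0 : ℝ) 1 := ⟨by linarith, by linarith [hx.2]⟩
      have h₁ := ih hxy (by linarith)
      have h₂ := hsuper (x - y) y hxy ⟨hy, hlt.trans hx.2⟩ (by simpa using hx)
      rw [sub_add_cancel] at h₂
      linarith

/-- A continuous, nonnegative and midpoint concave function on `(0,1)` satisfies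
`g x ≤ 2 * g (x / 2)`. -/
theorem le_two_mul_half_of_midpoint_concave {g : ℝ → ℝ}
    (hcont : ContinuousOn g (Ioo 0 1)) (hnonneg : ∀ x ∈ Ioo (0 : ℝ) 1, 0 ≤ g x)
    (hmid : ∀ x y : ℝ, x ∈ Ioo (0 : ℝ) 1 → y ∈ Ioo (0 : ℝ) 1 →
      x + y ∈ Ioo (0 : ℝ) 1 → (g x + g y) / 2 ≤ g ((x + y) / 2))
    {x : ℝ} (hx : x ∈ Ioo (0 : ℝ) 1) : g x ≤ 2 * g (x / 2) := by
  obtain ⟨hx0, hx1⟩ := hx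
  have hg : ContinuousAt g ((x + 0) / 2) :=
    hcont.continuousAt (Ioo_mem_nhds (by linarith) (by linarith))
  have hlim : Tendsto (fun y => g ((x + y) / 2)) (𝓝[>] 0) (𝓝 (g ((x + 0) / 2))) :=
    (ContinuousAt.comp (f := fun y : ℝ => (x + y) / 2) hg (by fun_prop)).tendsto.mono_left
      nhdsWithin_le_nhds
  have hle : g x / 2 ≤ g ((x + 0) / 2) := by
    refine ge_of_tendsto hlim ?_
    filter_upwards [Ioo_mem_nhdsGT (show (0 : ℝ) < 1 - x by linarith)] with y hy
    have hy' : y ∈ Ioo (0 : ℝ) 1 := ⟨hy.1, by linarith [hy.2]⟩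
    have := hmid x y ⟨hx0, hx1⟩ hy' ⟨by linarith [hy.1], by linarith [hy.2]⟩
    linarith [hnonneg y hy']
  rw [add_zero] at hle
  linarith

/-- A nonnegative superadditive function on `(0,1)` with `g x ≤ 2 * g (x / 2)` satisfies
`x / y * g y ≤ g x` for all `x` and `y`. -/
theorem div_mul_le_of_superadditive {g : ℝ → ℝ}
    (hnonneg : ∀ x ∈ Ioo (0 : ℝ) 1, 0 ≤ g x)
    (hsuper : ∀ x y : ℝ, x ∈ Ioo (0 : ℝ) 1 → y ∈ Ioo (0 : ℝ) 1 →
      x + y ∈ Ioo (0 : ℝ) 1 → g x + g y ≤ g (x + y))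
    (hhalf : ∀ x ∈ Ioo (0 : ℝ) 1, g x ≤ 2 * g (x / 2))
    {x y : ℝ} (hx : x ∈ Ioo (0 : ℝ) 1) (hy : y ∈ Ioo (0 : ℝ) 1) :
    x / y * g y ≤ g x := by
  have hy0 := hy.1
  have hpow (k : ℕ) : g y ≤ 2 ^ k * g (y / 2 ^ k) := by
    induction k with
    | zero => simp
    | succ k ih =>
      have hmem : y / 2 ^ k ∈ Ioo (0 : ℝ) 1 :=
        ⟨by positivity, (div_le_self hy0.le (one_le_pow₀ one_le_two)).trans_lt hy.2⟩
      calc g y ≤ 2 ^ k * g (y / 2 ^ k) := ih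
        _ ≤ 2 ^ k * (2 * g (y / 2 ^ k / 2)) := by gcongr; exact hhalf _ hmem
        _ = 2 ^ (k + 1) * g (y / 2 ^ (k + 1)) := by rw [div_div, ← pow_succ]; ring
  have hbound (k : ℕ) : (x / y - (1 / 2) ^ k) * g y ≤ g x := by
    have hr : 0 ≤ 2 ^ k * (x / y) := by have := hx.1; positivity
    set m := ⌊2 ^ k * (x / y)⌋₊
    have hm : (m : ℝ) ≤ 2 ^ k * (x / y) := Nat.floor_le hr
    have hm' : 2 ^ k * (x / y) < m + 1 := Nat.lt_floor_add_one _
    have hmx : m * (y / 2 ^ k) ≤ x := by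
      calc m * (y / 2 ^ k) ≤ 2 ^ k * (x / y) * (y / 2 ^ k) := by gcongr
        _ = x := by field_simp
    calc (x / y - (1 / 2) ^ k) * g y ≤ m / 2 ^ k * g y := by
          refine mul_le_mul_of_nonneg_right ?_ (hnonneg y hy)
          rw [le_div_iff₀ (by positivity), sub_mul, ← mul_pow]
          norm_num
          linarith
      _ ≤ m / 2 ^ k * (2 ^ k * g (y / 2 ^ k)) := by gcongr; exact hpow k
      _ = m * g (y / 2 ^ k) := by field_simp
      _ ≤ g x := natCast_mul_le_of_superadditive hnonneg hsuper (by positivity) m hx hmx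
  have hzero : Tendsto (fun k : ℕ => ((1 : ℝ) / 2) ^ k) atTop (𝓝 0) :=
    tendsto_pow_atTop_nhds_zero_of_lt_one (by norm_num) (by norm_num)
  have hlim := (hzero.const_sub (x / y)).mul_const (g y)
  rw [sub_zero] at hlim
  exact le_of_tendsto' hlim hbound

/-- A continuous function on `(0,1)` that is positive on `(0,1/2)`, superadditive on
`(0,1)`, and midpoint concave on `(0,1)` must be linear: `g(x) = x/q` for some `q > 0`. -/
theorem superadditive_midpoint_concave_linear
    (g : ℝ → ℝ)
    (hcont : ContinuousOn g (Set.Ioo 0 1))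
    (hpos : ∀ x ∈ Set.Ioo (0:ℝ) (1/2), 0 < g x)
    (hsuper : ∀ x y : ℝ, x ∈ Set.Ioo (0:ℝ) 1 → y ∈ Set.Ioo (0:ℝ) 1 →
      x + y ∈ Set.Ioo (0:ℝ) 1 → g x + g y ≤ g (x + y))
    (hmid : ∀ x y : ℝ, x ∈ Set.Ioo (0:ℝ) 1 → y ∈ Set.Ioo (0:ℝ) 1 →
      x + y ∈ Set.Ioo (0:ℝ) 1 → (g x + g y) / 2 ≤ g ((x + y) / 2)) :
    ∃ q : ℝ, 0 < q ∧ ∀ x ∈ Set.Ioo (0:ℝ) 1, g x = x / q := by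
  have hnonneg : ∀ x ∈ Ioo (0 : ℝ) 1, 0 ≤ g x := by
    intro x ⟨hx0, hx1⟩
    have hx2 : x / 2 ∈ Ioo (0 : ℝ) 1 := ⟨by linarith, by linarith⟩
    have h := hsuper (x / 2) (x / 2) hx2 hx2 (by rw [add_halves]; exact ⟨hx0, hx1⟩)
    rw [add_halves] at h
    linarith [hpos (x / 2) ⟨by linarith, by linarith⟩]
  have hratio {x y : ℝ} (hx : x ∈ Ioo (0 : ℝ) 1) (hy : y ∈ Ioo (0 : ℝ) 1) :
      x / y * g y ≤ g x :=
    div_mul_le_of_superadditive hnonneg hsuper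
      (fun _ hz => le_two_mul_half_of_midpoint_concave hcont hnonneg hmid hz) hx hy
  have hc : (1 / 4 : ℝ) ∈ Ioo (0 : ℝ) 1 := by norm_num
  have hgc : 0 < g (1 / 4) := hpos _ (by norm_num)
  refine ⟨1 / 4 / g (1 / 4), by positivity, fun x hx => ?_⟩
  have h₁ := hratio hx hc
  have h₂ := hratio hc hx
  have hx0 := hx.1
  rw [div_mul_eq_mul_div, div_le_iff₀ hx0] at h₂
  rw [div_div_eq_mul_div]
  linarith
end

section
/- Let φ: ℝ → (0,∞) be a strictly increasing deformed exponential function which is differentiable with φ' > 0, whose inverse φ⁻¹: (0,∞) → ℝ is differentiable with (φ⁻¹)' > 0. Suppose the generalized divergence D_φ satisfies the partition inequality D_φ(p‖q) ≥ D_φ(p^𝒜‖q^𝒜) for all probability distributions p, q with strictly positive entries and all partitions 𝒜 of {1,…,n}, and suppose that c = inf_{0<p<q<1} (1/8)·(1/(q−p))·[ −(φ⁻¹)'(q)/(φ⁻¹)'(p) + (φ⁻¹)'(1−q)/(φ⁻¹)'(1−p) ] > 0. Then for all probability distributions p = (p_i) and q = (q_i) with strictly positive entries, D_φ(p‖q)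 ≥ c·‖p − q‖₁², where ‖p − q‖₁ = ∑_{i=1}^{n} |p_i − q_i|. -/
open Filter Set

/-- A lower bound on a real infimum known to be positive needs no separate boundedness check:
the infimum of a set which is not bounded below is `0`. -/
lemma le_of_sInf_pos {S : Set ℝ} (h : 0 < sInf S) {r : ℝ} (hr : r ∈ S) : sInf S ≤ r := by
  refine csInf_le ?_ hr
  by_contra hb
  exact h.ne' (Real.sInf_of_not_bddBelow hb)

/-- The two-point case of the generalized Pinsker inequality. -/
lemma binary_divergence_lower_bound {f f' : ℝ → ℝ} {c P Q : ℝ}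
    (hf : ∀ x, 0 < x → HasDerivAt f (f' x) x)
    (hP : 0 < P) (hPQ : P < Q) (hQ : Q < 1)
    (hc : ∀ t, P < t → t < 1 →
      c ≤ 1/8 * (1/(t - P)) * (-(f' t / f' P) + f' (1 - t) / f' (1 - P))) :
    4 * c * (Q - P) ^ 2 ≤ (f P - f Q) / f' P + (f (1 - P) - f (1 - Q)) / f' (1 - P) := by
  set g : ℝ → ℝ := fun t =>
    (f P - f t) / f' P + (f (1 - P) - f (1 - t)) / f' (1 - P) - 4 * c * (t - P) ^ 2 with hg
  have hderiv : ∀ t, 0 < t → t < 1 → HasDerivAt g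
      (-(f' t / f' P) + f' (1 - t) / f' (1 - P) - 8 * c * (t - P)) t := by
    intro t h0 h1
    have hfst := ((hf t h0).const_sub (f P)).div_const (f' P)
    have hcomp : HasDerivAt (fun t => f (1 - t)) (f' (1 - t) * -1) t :=
      HasDerivAt.comp t (hf (1 - t) (by linarith)) ((hasDerivAt_id t).const_sub 1)
    have hsnd := (hcomp.const_sub (f (1 - P))).div_const (f' (1 - P))
    have hsq := (((hasDerivAt_id t).sub_const P).pow 2).const_mul (4 * c)
    refine ((hfst.add hsnd).sub hsq).congr_deriv ?_
    simp
    ring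
  have hmono : MonotoneOn g (Icc P Q) := by
    refine monotoneOn_of_deriv_nonneg (convex_Icc P Q) ?_ ?_ ?_
    · exact fun t ht => (hderiv t (by linarith [ht.1]) (by linarith [ht.2])).continuousAt.continuousWithinAt
    · rw [interior_Icc]
      exact fun t ht => (hderiv t (by linarith [ht.1]) (by linarith [ht.2])).differentiableAt.differentiableWithinAt
    · rw [interior_Icc]
      intro t ht
      rw [(hderiv t (by linarith [ht.1]) (by linarith [ht.2])).deriv]
      have hpos : 0 < t - P := sub_pos.2 ht.1
      have hle := mul_le_mul_of_nonneg_left (hc t ht.1 (by linarith [ht.2]))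
        (by positivity : 0 ≤ 8 * (t - P))
      have hcancel : 8 * (t - P) *
          (1/8 * (1/(t - P)) * (-(f' t / f' P) + f' (1 - t) / f' (1 - P)))
          = -(f' t / f' P) + f' (1 - t) / f' (1 - P) := by
        field_simp
      linarith
  have hle := hmono (left_mem_Icc.2 hPQ.le) (right_mem_Icc.2 hPQ.le) hPQ.le
  simp only [hg, sub_self, zero_div] at hle
  linarith

/-- For vectors of equal total, the `ℓ¹` distance is twice the excess of `q` over `p` on the
set where `p < q`. -/
lemma sum_abs_sub_eq_two_mul {ι : Type*} [Fintype ι] {p q : ι → ℝ}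
    (h : ∑ i, p i = ∑ i, q i) :
    ∑ i, |p i - q i| =
      2 * (∑ i with p i < q i, q i - ∑ i with p i < q i, p i) := by
  have habs : ∀ i, |p i - q i| = (p i - q i) + 2 * (if p i < q i then q i - p i else 0) := by
    intro i
    split_ifs with hi
    · rw [abs_of_neg (by linarith)]; ring
    · rw [abs_of_nonneg (by linarith)]; ring
  rw [Finset.sum_congr rfl fun i _ => habs i, Finset.sum_add_distrib, ← Finset.mul_sum,
    ← Finset.sum_filter, Finset.sum_sub_distrib, Finset.sum_sub_distrib, h]
  ring

/-- Pinsker's inequality for the generalized divergence: if the partition inequality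
holds and the constant
`c = inf_{0<s<t<1} (1/8)(1/(t−s))[−(φ⁻¹)'(t)/(φ⁻¹)'(s) + (φ⁻¹)'(1−t)/(φ⁻¹)'(1−s)]`
is positive, then `D_φ(p‖q) ≥ c‖p−q‖₁²`. Partitions of `{1,…,n}` are encoded as
surjective maps `A : Fin n → Fin k`. -/
theorem pinsker_inequality_generalized
    (φ φ' φinv φinv' : ℝ → ℝ)
    -- φ is a strictly positive, strictly increasing deformed exponential
    (hφpos : ∀ u, 0 < φ u)
    (hφconv : ConvexOn ℝ Set.univ φ)
    (hφmono : StrictMono φ)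
    (hφbot : Tendsto φ atBot (nhds 0))
    (hφtop : Tendsto φ atTop atTop)
    -- φ is differentiable with φ' > 0
    (hφd : ∀ u, HasDerivAt φ (φ' u) u)
    (hφ'pos : ∀ u, 0 < φ' u)
    -- φinv is the inverse of φ, differentiable on (0,∞) with (φ⁻¹)' > 0
    (hinv_left : ∀ u, φinv (φ u) = u)
    (hinv_right : ∀ x : ℝ, 0 < x → φ (φinv x) = x)
    (hinvd : ∀ x : ℝ, 0 < x → HasDerivAt φinv (φinv' x) x)
    (hinv'pos : ∀ x : ℝ, 0 < x → 0 < φinv' x)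
    (n : ℕ)
    -- the partition inequality holds
    (hpart : ∀ (k : ℕ) (A : Fin n → Fin k), Function.Surjective A →
      ∀ p q : Fin n → ℝ, (∀ i, 0 < p i) → (∀ i, 0 < q i) →
        ∑ i, p i = 1 → ∑ i, q i = 1 →
        ∑ j : Fin k,
            (φinv (∑ i ∈ Finset.univ.filter (fun i => A i = j), p i) -
              φinv (∑ i ∈ Finset.univ.filter (fun i => A i = j), q i)) /
              φinv' (∑ i ∈ Finset.univ.filter (fun i => A i = j), p i)
          ≤ ∑ i, (φinv (p i) - φinv (q i)) / φinv' (p i))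
    -- the Pinsker constant c
    (c : ℝ)
    (hc : c = sInf {r : ℝ | ∃ s t : ℝ, 0 < s ∧ s < t ∧ t < 1 ∧
      r = 1/8 * (1/(t - s)) * (-(φinv' t / φinv' s) + φinv' (1 - t) / φinv' (1 - s))})
    (hcpos : 0 < c)
    -- p and q are probability distributions with strictly positive entries
    (p q : Fin n → ℝ)
    (hp : ∀ i, 0 < p i) (hq : ∀ i, 0 < q i)
    (hps : ∑ i, p i = 1) (hqs : ∑ i, q i = 1) :
    c * (∑ i, |p i - q i|) ^ 2 ≤ ∑ i, (φinv (p i) - φinv (q i)) / φinv' (p i) := by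
  by_cases hlt : ∃ i, p i < q i
  swap
  · push Not at hlt
    have heq : ∀ i, q i = p i := fun i =>
      (Finset.sum_eq_sum_iff_of_le fun i _ => hlt i).1 (hqs.trans hps.symm) i (Finset.mem_univ i)
    simp [heq]
  obtain ⟨a, ha⟩ := hlt
  obtain ⟨b, hb⟩ : ∃ b, ¬ p b < q b := by
    by_contra! hall
    have := Finset.sum_lt_sum_of_nonempty ⟨a, Finset.mem_univ a⟩ fun i _ => hall i
    linarith
  set P := ∑ i with p i < q i, p i with hPdef
  set Q := ∑ i with p i < q i, q i with hQdef
  have hPc : ∑ i with ¬ p i < q i, p i = 1 - P := by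
    rw [← hps, ← Finset.sum_filter_add_sum_filter_not Finset.univ (fun i => p i < q i) p]
    ring
  have hQc : ∑ i with ¬ p i < q i, q i = 1 - Q := by
    rw [← hqs, ← Finset.sum_filter_add_sum_filter_not Finset.univ (fun i => p i < q i) q]
    ring
  have hPpos : 0 < P := Finset.sum_pos (fun i _ => hp i) ⟨a, by simpa using ha⟩
  have hQlt : Q < 1 := by
    have : 0 < ∑ i with ¬ p i < q i, q i :=
      Finset.sum_pos (fun i _ => hq i) ⟨b, by simpa using hb⟩
    linarith
  have hPQ : P < Q := Finset.sum_lt_sum_of_nonempty ⟨a, by simpa using ha⟩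
    fun i hi => (Finset.mem_filter.1 hi).2
  have hbin := binary_divergence_lower_bound (c := c) hinvd hPpos hPQ hQlt fun t hPt ht => by
    rw [hc] at hcpos ⊢
    exact le_of_sInf_pos hcpos ⟨P, t, hPpos, hPt, ht, rfl⟩
  have hdata := hpart 2 (fun i => if p i < q i then 0 else 1)
    (fun j => by
      fin_cases j
      · exact ⟨a, by simp [ha]⟩
      · exact ⟨b, by simp [hb]⟩) p q hp hq hps hqs
  have hfst : ∀ i, ((if p i < q i then 0 else 1 : Fin 2) = 0) ↔ p i < q i := fun i => by
    split_ifs with hi <;> simp [hi]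
  have hsnd : ∀ i, ((if p i < q i then 0 else 1 : Fin 2) = 1) ↔ ¬ p i < q i := fun i => by
    split_ifs with hi <;> simp [hi]
  simp only [Fin.sum_univ_two, hfst, hsnd, hPc, hQc, ← hPdef, ← hQdef] at hdata
  have hnorm : ∑ i, |p i - q i| = 2 * (Q - P) := sum_abs_sub_eq_two_mul (hps.trans hqs.symm)
  rw [hnorm]
  linarith
end
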